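/- For every solution P = (E_P, λ_P) of the instance (T, 6k−1, 4k) and every i ∈ {1,...,3k}, the subtree T_i contains no lowest P-component with fewer than s/4 vertices. -/

import Mathlib

namespace TP

/-- Rooted binary trees. -/
inductive RBT : Type where
  | nil : RBT
  | node : RBT → RBT → RBT

/-- The number of vertices of a rooted binary tree. -/
def RBT.size : RBT → ℕ
  | .nil => 0
  | .node l r => l.size + r.size + 1

/-- A nice binary tree: it has at most one vertex, or its left and right subtrees are
nice binary trees whose numbers of vertices differ by at most 1. -/
def RBT.IsNice : RBT → Prop
  | .nil => True
  | .node l r => l.IsNice ∧ r.IsNice ∧ Nat.dist l.size r.size ≤ 1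

/-- Valid positions (vertices) of a rooted binary tree, encoded as lists of booleans:
`false` means "go to the left child", `true` means "go to the right child". -/
def RBT.Valid : RBT → List Bool → Prop
  | .nil, _ => False
  | .node _ _, [] => True
  | .node l _, (false :: bs) => RBT.Valid l bs
  | .node _ r, (true :: bs) => RBT.Valid r bs

/-- The vertex type of the tree `T` built from the path `H = (p_1, …, p_{3k})` (the `Sum.inl`
part) together with, for each `i`, the binary tree `T_i` with shape `Tsh i` (the `Sum.inr` part,
vertices of `T_i` being its valid positions). -/
abbrev Vtx (k : ℕ) (Tsh : Fin (3*k) → RBT) : Type :=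
  Fin (3*k) ⊕ (Σ i : Fin (3*k), {l : List Bool // (Tsh i).Valid l})

/-- The tree `T`: the path `p_1 — p_2 — ⋯ — p_{3k}`, an edge between `p_i` and the root `[]`
of `T_i` for each `i`, and the parent-child edges inside each binary tree `T_i`. -/
def TGraph (k : ℕ) (Tsh : Fin (3*k) → RBT) : SimpleGraph (Vtx k Tsh) :=
  SimpleGraph.fromRel (fun v w =>
    match v, w with
    | Sum.inl i, Sum.inl j => (i : ℕ) + 1 = (j : ℕ)
    | Sum.inl i, Sum.inr ⟨j, x⟩ => i = j ∧ x.1 = []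
    | Sum.inr ⟨i, x⟩, Sum.inr ⟨j, y⟩ => i = j ∧ ∃ c : Bool, y.1 = x.1 ++ [c]
    | _, _ => False)

/-- Combine the shapes of the left subtrees `L_i` and right subtrees `R_i` into
the shapes of the trees `T_i`. -/
def nodes {ι : Type} (L R : ι → RBT) : ι → RBT := fun i => RBT.node (L i) (R i)

/-- The vertex set of the subtree `T_i`. -/
def TiSet (k : ℕ) (Tsh : Fin (3*k) → RBT) (i : Fin (3*k)) : Set (Vtx k Tsh) :=
  {v | ∃ x : {l : List Bool // (Tsh i).Valid l}, v = Sum.inr ⟨i, x⟩}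

/-- The vertex set of the left subtree `L_i` of `T_i` (positions starting with `false`). -/
def LiSet (k : ℕ) (Tsh : Fin (3*k) → RBT) (i : Fin (3*k)) : Set (Vtx k Tsh) :=
  {v | ∃ x : {l : List Bool // (Tsh i).Valid l}, x.1.head? = some false ∧ v = Sum.inr ⟨i, x⟩}

/-- The vertex set of the right subtree `R_i` of `T_i` (positions starting with `true`). -/
def RiSet (k : ℕ) (Tsh : Fin (3*k) → RBT) (i : Fin (3*k)) : Set (Vtx k Tsh) :=
  {v | ∃ x : {l : List Bool // (Tsh i).Valid l}, x.1.head? = some true ∧ v = Sum.inr ⟨i, x⟩}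

/-- A solution `P = (E_P, λ_P)` cutting exactly `kk` edges: `E_P` is a set of exactly `kk`
edges of `G`, and `lam` assigns the connected components of `G − E_P` to `b` groups
(it is constant on each component), so that group `g` receives exactly `sizes g` vertices. -/
def IsSolutionEq {V : Type} (G : SimpleGraph V) (EP : Set (Sym2 V)) (kk b : ℕ)
    (sizes : Fin b → ℕ) (lam : V → Fin b) : Prop :=
  EP ⊆ G.edgeSet ∧ EP.ncard = kk ∧
    (∀ v w : V, (G.deleteEdges EP).Reachable v w → lam v = lam w) ∧
    ∀ g : Fin b, {v | lam v = g}.ncard = sizes g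

/-- `C` is a `P`-component: a connected component of `G − E_P`. -/
def IsPComp {V : Type} (G : SimpleGraph V) (EP : Set (Sym2 V)) (C : Set V) : Prop :=
  ∃ v : V, C = {w | (G.deleteEdges EP).Reachable v w}

end TP

namespace TP
def Cls (s a d : ℕ) : Prop := d = a ∨ d = s - 2 ∨ d = s/2 - 1 ∨ d = s/2 - 2

set_option maxHeartbeats 4000000 in
open Classical in
theorem core {α : Type} (k s : ℕ) (hk : 1 ≤ k) (hs4 : 4 ∣ s) (hs : 24 * k < s)
    (a : Fin (3*k) → ℕ) (ha : ∀ i, s / 4 + 6 * k ≤ a i ∧ a i ≤ s / 2 - 18 * k)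
    (X : Finset α) (hK : X.card ≤ 6 * k) (lam : α → Fin (4*k)) (w D : α → ℕ)
    (hg : ∀ g, ∑ t ∈ X with lam t = g, w t = s)
    (In : Fin (3*k) → Finset α) (hIn : ∀ i, In i ⊆ X)
    (hdis : ∀ i j, i ≠ j → Disjoint (In i) (In j))
    (h1 : ∀ i, a i ≤ ∑ t ∈ In i, w t)
    (hD : ∀ i, ∀ t ∈ In i, w t ≤ D t)
    (hcl : ∀ i, ∀ t ∈ In i, (D t = a i + s - 1 ∧ ∑ t ∈ In i, w t = D t) ∨ Cls s (a i) (D t) ∨ D t < s / 4)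
    (huniq : ∀ i, ∀ t ∈ In i, ∀ u ∈ In i, D t = a i + s - 1 → D u = a i + s - 1 → t = u)
    (hF : ∀ i, ∀ t ∈ In i, ∃ F ⊆ In i, t ∈ F ∧ D t = ∑ u ∈ F, w u)
    (i : Fin (3*k)) (C : α) (hC : C ∈ In i) (hCs : D C < s / 4) : False := by
  obtain ⟨q, rfl⟩ := hs4
  have hle : ∀ t ∈ X, w t ≤ 4 * q := by
    intro t ht
    rw [← hg (lam t)]
    exact Finset.single_le_sum (f := w) (fun _ _ => Nat.zero_le _) (by simp [ht])
  -- singletons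
  have hsing : ∀ j t, In j = {t} → Cls (4*q) (a j) (w t) := by
    intro j t hj
    have ht : t ∈ In j := by simp [hj]
    obtain ⟨F, hF1, hF2, hF3⟩ := hF j t ht
    have : F = {t} := by
      rw [hj] at hF1
      exact Finset.Subset.antisymm hF1 (by simpa using hF2)
    subst this
    have e1 : D t = w t := by simpa using hF3
    have e2 := h1 j
    rw [hj] at e2
    simp at e2
    have := hle t (hIn j ht)
    have := ha j
    rcases hcl j t ht with h | h | h
    · omega
    · rwa [← e1]
    · omega
  -- full weight
  have hfull : ∀ j, ∀ t ∈ In j, w t = 4 * q → D t = a j + 4 * q - 1 ∧ ∑ t ∈ In j, w t = D t := by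
    intro j t ht h
    have := hD j t ht
    have := ha j
    rcases hcl j t ht with h | h | h
    · exact h
    · unfold Cls at h; omega
    · omega
  set φ : α → ℕ := fun t => if w t = 4 * q then 3 else if ∃ j, In j = {t} then 1 else 2 with hφ
  have hφ3 : ∀ t, φ t ≤ 3 := by
    intro t; simp only [hφ]; split_ifs <;> omega
  have hφ1 : ∀ t, 1 ≤ φ t := by
    intro t; simp only [hφ]; split_ifs <;> omega
  have hφe1 : ∀ t, φ t = 1 → ∃ j, In j = {t} := by
    intro t h; simp only [hφ] at h; split_ifs at h <;> first | assumption | omega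
  have hφe3 : ∀ t, φ t = 3 → w t = 4 * q := by
    intro t h; simp only [hφ] at h; split_ifs at h <;> first | assumption | omega
  -- groups
  have hgrp : ∀ g : Fin (4*k), 3 ≤ ∑ t ∈ X with lam t = g, φ t := by
    intro g
    have hgg := hg g
    set Y := X.filter (fun t => lam t = g) with hY
    by_cases hc3 : 3 ≤ Y.card
    · calc 3 ≤ Y.card := hc3
        _ = ∑ t ∈ Y, 1 := by simp
        _ ≤ _ := Finset.sum_le_sum (fun t _ => hφ1 t)
    have : Y.card = 0 ∨ Y.card = 1 ∨ Y.card = 2 := by omega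
    rcases this with h | h | h
    · rw [Finset.card_eq_zero] at h
      rw [h] at hgg; simp at hgg; omega
    · obtain ⟨t, ht⟩ := Finset.card_eq_one.1 h
      rw [ht] at hgg ⊢
      simp at hgg ⊢
      simp [hφ, hgg]
    · obtain ⟨t, u, htu, ht⟩ := Finset.card_eq_two.1 h
      rw [ht] at hgg ⊢
      rw [Finset.sum_pair htu] at hgg ⊢
      by_contra hlt
      have := hφ1 t
      have := hφ1 u
      obtain ⟨j, hj⟩ := hφe1 t (by omega)
      obtain ⟨l, hl⟩ := hφe1 u (by omega)
      have := hsing j t hj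
      have := hsing l u hl
      have := ha j
      have := ha l
      unfold Cls at *
      omega
  -- deficiency
  have hmul : ∀ j, ∀ t ∈ In j, 2 ≤ (In j).card → 2 ≤ φ t := by
    intro j t ht hc
    by_contra hlt
    have := hφ1 t
    obtain ⟨l, hl⟩ := hφe1 t (by omega)
    by_cases hjl : j = l
    · subst hjl; rw [hl] at hc; simp at hc
    · have := hdis j l hjl
      rw [Finset.disjoint_left] at this
      exact this ht (by simp [hl])
  have hne : ∀ j, 1 ≤ (In j).card := by
    intro j
    rw [Nat.one_le_iff_ne_zero]
    intro h
    rw [Finset.card_eq_zero] at h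
    have e := h1 j
    have := ha j
    rw [h] at e; simp at e; omega
  have hS1 : ∀ j, ∀ t ∈ In j, ∀ u ∈ In j, φ t = 3 → φ u = 3 → t = u := by
    intro j t ht u hu h3 h3'
    exact huniq j t ht u hu (hfull j t ht (hφe3 t h3)).1 (hfull j u hu (hφe3 u h3')).1
  have hdef : ∀ j, 2 ≤ ∑ t ∈ In j, (3 - φ t) := by
    intro j
    have hc := hne j
    by_cases hc1 : (In j).card = 1
    · obtain ⟨t, ht⟩ := Finset.card_eq_one.1 hc1
      have h1' := hsing j t ht
      have := ha j
      have : φ t = 1 := by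
        have : w t ≠ 4 * q := by unfold Cls at h1'; omega
        simp only [hφ]
        rw [if_neg this, if_pos ⟨j, ht⟩]
      rw [ht]; simp [this]
    · by_cases hM : ∃ t ∈ In j, φ t = 3
      · obtain ⟨t, ht, h3⟩ := hM
        have hrest : ∀ u ∈ (In j).erase t, 1 ≤ 3 - φ u := by
          intro u hu
          rw [Finset.mem_erase] at hu
          have := hφ3 u
          by_contra hlt
          exact hu.1 (hS1 j u hu.2 t ht (by omega) h3)
        by_cases hc2 : (In j).card = 2
        · exfalso
          have hce : ((In j).erase t).card = 1 := by rw [Finset.card_erase_of_mem ht]; omega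
          obtain ⟨u, hu⟩ := Finset.card_eq_one.1 hce
          have huj : u ∈ In j ∧ u ≠ t := by
            have : u ∈ (In j).erase t := by simp [hu]
            rw [Finset.mem_erase] at this
            exact ⟨this.2, this.1⟩
          have hIj : In j = {t, u} := by
            rw [← hu, Finset.insert_erase ht]
          have hft := hfull j t ht (hφe3 t h3)
          have hwt := hφe3 t h3
          rw [hIj, Finset.sum_pair huj.2.symm] at hft
          obtain ⟨F, hF1, hF2, hF3⟩ := hF j u huj.1
          have hDu : D u ≠ a j + 4*q - 1 := fun h => huj.2 (huniq j u huj.1 t ht h hft.1)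
          have hFc : D u = w u ∨ D u = w t + w u := by
            by_cases htF : t ∈ F
            · right
              rw [hF3, ← Finset.sum_pair huj.2.symm]
              congr 1
              rw [← hIj]
              refine Finset.Subset.antisymm hF1 ?_
              rw [hIj]; intro z hz; simp at hz; rcases hz with rfl | rfl <;> assumption
            · left
              have : F = {u} := by
                ext z; constructor
                · intro hz
                  have := hF1 hz
                  rw [hIj] at this; simp at this ⊢
                  rcases this with rfl | rfl
                  · exact absurd hz htF
                  · rfl
                · intro hz; simp at hz; subst hz; exact hF2
              rw [hF3, this]; simp
          have := ha j
          have hcu := hcl j u huj.1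
          unfold Cls at hcu
          omega
        · have hce : 2 ≤ ((In j).erase t).card := by rw [Finset.card_erase_of_mem ht]; omega
          calc 2 ≤ ((In j).erase t).card := hce
            _ = ∑ u ∈ (In j).erase t, 1 := by simp
            _ ≤ ∑ u ∈ (In j).erase t, (3 - φ u) := Finset.sum_le_sum hrest
            _ ≤ _ := Finset.sum_le_sum_of_subset (Finset.erase_subset _ _)
      · push Not at hM
        calc 2 ≤ (In j).card := by omega
          _ = ∑ u ∈ In j, 1 := by simp
          _ ≤ _ := Finset.sum_le_sum (fun u hu => by
            have := hM u hu; have := hφ3 u; omega)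
  -- totals
  have T1 : ∑ g : Fin (4*k), ∑ t ∈ X with lam t = g, φ t = ∑ t ∈ X, φ t :=
    Finset.sum_fiberwise X lam φ
  have T2 : ∑ t ∈ X, (3 - φ t) + ∑ t ∈ X, φ t = 3 * X.card := by
    rw [← Finset.sum_add_distrib]
    rw [Finset.sum_congr rfl (g := fun _ => 3) (fun t _ => by have := hφ3 t; omega)]
    simp [mul_comm]
  have T3 : ∑ j, ∑ t ∈ In j, (3 - φ t) ≤ ∑ t ∈ X, (3 - φ t) := by
    rw [← Finset.sum_biUnion (fun x _ y _ h => hdis x y h)]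
    exact Finset.sum_le_sum_of_subset (by
      intro t ht; simp at ht; obtain ⟨j, hj⟩ := ht; exact hIn j hj)
  have T4 : ∑ g : Fin (4*k), 3 ≤ ∑ g : Fin (4*k), ∑ t ∈ X with lam t = g, φ t :=
    Finset.sum_le_sum (fun g _ => hgrp g)
  have T5 : ∑ j : Fin (3*k), 2 ≤ ∑ j, ∑ t ∈ In j, (3 - φ t) :=
    Finset.sum_le_sum (fun g _ => hdef g)
  have c4 : ∑ g : Fin (4*k), 3 = 12 * k := by simp; ring
  have c5 : ∑ g : Fin (3*k), 2 = 6 * k := by simp; ring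
  have E4 : ∀ g, 3 = ∑ t ∈ X with lam t = g, φ t := by
    have := (Finset.sum_eq_sum_iff_of_le (s := Finset.univ) (fun g _ => hgrp g)).1 (by omega)
    exact fun g => this g (Finset.mem_univ g)
  have E5 : ∀ j, 2 = ∑ t ∈ In j, (3 - φ t) := by
    have := (Finset.sum_eq_sum_iff_of_le (s := Finset.univ) (fun g _ => hdef g)).1 (by omega)
    exact fun g => this g (Finset.mem_univ g)
  -- partner
  have hpart : ∀ t ∈ X, φ t = 2 → ∃ j u, Cls (4*q) (a j) (w u) ∧ w t + w u = 4 * q := by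
    intro t ht h2
    have e := E4 (lam t)
    have e' := hg (lam t)
    have htm : t ∈ X.filter (fun u => lam u = lam t) := by simp [ht]
    rw [← Finset.add_sum_erase _ _ htm] at e e'
    have e1 : ∑ x ∈ (X.filter (fun u => lam u = lam t)).erase t, φ x = 1 := by omega
    have hcard : ((X.filter (fun u => lam u = lam t)).erase t).card ≤ 1 := by
      rw [← e1, Finset.card_eq_sum_ones]
      exact Finset.sum_le_sum (fun u _ => hφ1 u)
    have : ((X.filter (fun u => lam u = lam t)).erase t).card = 0 ∨ ((X.filter (fun u => lam u = lam t)).erase t).card = 1 := by omega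
    rcases this with h | h
    · rw [Finset.card_eq_zero] at h; rw [h] at e1; simp at e1
    · obtain ⟨u, hu⟩ := Finset.card_eq_one.1 h
      rw [hu] at e1 e'
      simp at e1 e'
      obtain ⟨j, hj⟩ := hφe1 u e1
      exact ⟨j, u, hsing j u hj, e'⟩
  -- the end
  have hwC := hD i C hC
  have hai := ha i
  have hc2 : 2 ≤ (In i).card := by
    by_contra hlt
    have := hne i
    obtain ⟨t, ht⟩ := Finset.card_eq_one.1 (show (In i).card = 1 by omega)
    have : C = t := by rw [ht] at hC; simpa using hC
    subst this
    have := hsing i C ht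
    unfold Cls at this
    omega
  have hφC : φ C = 2 := by
    have := hmul i C hC hc2
    have := hφ3 C
    by_contra h
    have := hφe3 C (by omega)
    omega
  obtain ⟨j, u, hju, hCu⟩ := hpart C (hIn i hC) hφC
  have haj := ha j
  have hwC2 : w C = 2 := by unfold Cls at hju; omega
  have e := E5 i
  rw [← Finset.add_sum_erase _ _ hC] at e
  have e1 : ∑ t ∈ (In i).erase C, (3 - φ t) = 1 := by omega
  obtain ⟨Y, hY, hY1⟩ : ∃ Y ∈ (In i).erase C, φ Y ≠ 3 := by
    by_contra hno
    push Not at hno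
    rw [Finset.sum_congr rfl (g := fun _ => 0) (fun t ht => by rw [hno t ht])] at e1
    simp at e1
  rw [← Finset.add_sum_erase _ _ hY] at e1
  have hYm := Finset.mem_erase.1 hY
  have hφY : φ Y = 2 := by
    have := hmul i Y hYm.2 hc2
    have := hφ3 Y
    omega
  have e2 : ∑ t ∈ ((In i).erase C).erase Y, (3 - φ t) = 0 := by omega
  rw [Finset.sum_eq_zero_iff] at e2
  have hrest : ∀ t ∈ ((In i).erase C).erase Y, φ t = 3 := fun t ht => by
    have := e2 t ht; have := hφ3 t; omega
  obtain ⟨j', u', hju', hYu⟩ := hpart Y (hIn i hYm.2) hφY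
  have haj' := ha j'
  have hsum : ∑ t ∈ In i, w t = w C + (w Y + ∑ t ∈ ((In i).erase C).erase Y, w t) := by
    rw [Finset.add_sum_erase _ _ hY, Finset.add_sum_erase _ _ hC]
  by_cases hemp : ((In i).erase C).erase Y = ∅
  · obtain ⟨F, hF1, hF2, hF3⟩ := hF i Y hYm.2
    have hIi : In i = {C, Y} := by
      rw [← Finset.insert_erase hC, ← Finset.insert_erase hY, hemp]; rfl
    rw [hemp] at hsum
    simp at hsum
    have h1i := h1 i
    have hFc : D Y = w Y ∨ D Y = w C + w Y := by
      by_cases htF : C ∈ F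
      · right
        rw [hF3, ← Finset.sum_pair hYm.1.symm]
        congr 1
        rw [← hIi]
        refine Finset.Subset.antisymm hF1 ?_
        rw [hIi]; intro z hz; simp at hz; rcases hz with rfl | rfl <;> assumption
      · left
        have : F = {Y} := by
          ext z; constructor
          · intro hz
            have := hF1 hz
            rw [hIi] at this; simp at this ⊢
            rcases this with rfl | rfl
            · exact absurd hz htF
            · rfl
          · intro hz; simp at hz; subst hz; exact hF2
        rw [hF3, this]; simp
    have hcY := hcl i Y hYm.2
    unfold Cls at hcY hju'
    omega
  · obtain ⟨Z, hZ⟩ := Finset.nonempty_iff_ne_empty.2 hemp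
    have hZi : Z ∈ In i := Finset.mem_of_mem_erase (Finset.mem_of_mem_erase hZ)
    have hwZ := hφe3 Z (hrest Z hZ)
    have hZf := hfull i Z hZi hwZ
    have : ((In i).erase C).erase Y = {Z} := by
      ext z; constructor
      · intro hz
        simp
        exact hS1 i z (Finset.mem_of_mem_erase (Finset.mem_of_mem_erase hz)) Z hZi (hrest z hz) (hrest Z hZ)
      · intro hz; simp only [Finset.mem_singleton] at hz; subst hz; exact hZ
    rw [this] at hsum
    simp only [Finset.sum_singleton] at hsum
    unfold Cls at hju'
    omega
end TP
namespace TP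

def subt : RBT → List Bool → RBT
  | t, [] => t
  | .nil, _ :: _ => .nil
  | .node l _, (false :: bs) => subt l bs
  | .node _ r, (true :: bs) => subt r bs

theorem valid_append (t : RBT) (l x : List Bool) (hx : (subt t l).Valid x) : t.Valid (l ++ x) := by
  induction l generalizing t with
  | nil => simpa [subt] using hx
  | cons b l ih =>
    cases t with
    | nil => simp [subt, RBT.Valid] at hx
    | node a c => cases b <;> simp only [subt, List.cons_append, RBT.Valid] at * <;> exact ih _ hx

theorem valid_append' (t : RBT) (l x : List Bool) (hx : t.Valid (l ++ x)) : (subt t l).Valid x := by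
  induction l generalizing t with
  | nil => simpa [subt] using hx
  | cons b l ih =>
    cases t with
    | nil => simp [RBT.Valid] at hx
    | node a c => cases b <;> simp only [subt, List.cons_append, RBT.Valid] at * <;> exact ih _ hx

theorem valid_nil_of (t : RBT) (x : List Bool) (hx : t.Valid x) : t.Valid [] := by
  cases t with
  | nil => simp [RBT.Valid] at hx
  | node a c => trivial

theorem valid_prefix (t : RBT) (l x : List Bool) (hx : t.Valid (l ++ x)) : t.Valid l := by
  have := valid_append t l [] (valid_nil_of _ _ (valid_append' t l x hx))
  simpa using this

theorem valid_dropLast (t : RBT) (x : List Bool) (hx : t.Valid x) : t.Valid x.dropLast := by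
  obtain ⟨y, hy⟩ := List.dropLast_prefix x
  exact valid_prefix t _ y (by rw [hy]; exact hx)

theorem valid_card (t : RBT) : {x | t.Valid x}.Finite ∧ {x | t.Valid x}.ncard = t.size := by
  induction t with
  | nil => simp [RBT.Valid, RBT.size]
  | node l r hl hr =>
    have e : {x | (RBT.node l r).Valid x} =
        insert [] ((List.cons false '' {x | l.Valid x}) ∪ (List.cons true '' {x | r.Valid x})) := by
      ext x
      rcases x with _ | ⟨_ | _, x⟩ <;> simp [RBT.Valid]
    have f1 := hl.1.image (List.cons false)
    have f2 := hr.1.image (List.cons true)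
    rw [e]
    refine ⟨(f1.union f2).insert _, ?_⟩
    rw [Set.ncard_insert_of_notMem (by simp) (f1.union f2), Set.ncard_union_eq _ f1 f2,
      Set.ncard_image_of_injective _ List.cons_injective,
      Set.ncard_image_of_injective _ List.cons_injective, hl.2, hr.2, RBT.size]
    rw [Set.disjoint_left]
    rintro x ⟨y, _, rfl⟩ ⟨z, _, h⟩
    simp at h

theorem sub_card (t : RBT) (l : List Bool) :
    {x | t.Valid x ∧ l <+: x}.ncard = (subt t l).size := by
  have : {x | t.Valid x ∧ l <+: x} = (fun x => l ++ x) '' {x | (subt t l).Valid x} := by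
    ext x; constructor
    · rintro ⟨h, y, rfl⟩
      exact ⟨y, valid_append' _ _ _ h, rfl⟩
    · rintro ⟨y, h, rfl⟩
      exact ⟨valid_append _ _ _ h, List.prefix_append _ _⟩
  rw [this, Set.ncard_image_of_injective _ (List.append_right_injective l), (valid_card _).2]

theorem subt_size_le (t : RBT) (l : List Bool) : (subt t l).size ≤ t.size := by
  induction l generalizing t with
  | nil => simp [subt]
  | cons b l ih =>
    cases t with
    | nil => simp [subt]
    | node a c =>
      have h1 := ih a
      have h2 := ih c
      cases b <;> simp only [subt, RBT.size] <;> omega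

theorem nice_half (t : RBT) (ht : t.IsNice) (b : Bool) (l : List Bool) :
    (subt t (b :: l)).size ≤ t.size / 2 := by
  cases t with
  | nil => simp [subt, RBT.size]
  | node a c =>
    have h1 := subt_size_le a l
    have h2 := subt_size_le c l
    have h3 := ht.2.2
    unfold Nat.dist at h3
    cases b <;> simp only [subt, RBT.size] <;> omega

theorem cls_lemma (s k a : ℕ) (hk : 1 ≤ k) (hs4 : 4 ∣ s) (hs : 24 * k < s)
    (ha : s / 4 + 6 * k ≤ a ∧ a ≤ s / 2 - 18 * k) (L R : RBT)
    (hL : L.IsNice ∧ L.size = a) (hR : R.IsNice ∧ R.size = s - 2) (y : List Bool) (hy : y ≠ []) :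
    Cls s a (subt (.node L R) y).size ∨ (subt (.node L R) y).size < s / 4 := by
  obtain ⟨q, rfl⟩ := hs4
  unfold Cls
  rcases y with _ | ⟨_ | _, y⟩
  · exact absurd rfl hy
  · simp only [subt]
    rcases y with _ | ⟨b, y⟩
    · simp only [subt]; omega
    · have := nice_half L hL.1 b y
      omega
  · simp only [subt]
    rcases y with _ | ⟨b, y⟩
    · simp only [subt]; omega
    · obtain ⟨hR1, hR2⟩ := hR
      cases R with
      | nil => simp [RBT.size] at hR2; omega
      | node u v =>
        have h3 := hR1.2.2
        unfold Nat.dist at h3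
        simp only [RBT.size] at hR2
        rcases y with _ | ⟨b', y⟩
        · cases b <;> simp only [subt] <;> omega
        · have h1 := nice_half u hR1.1 b' y
          have h2 := nice_half v hR1.2.1 b' y
          cases b <;> simp only [subt] <;> omega
end TP
namespace TP

section graph
variable {k : ℕ} {Tsh : Fin (3*k) → RBT}

def par : Vtx k Tsh → Vtx k Tsh
  | Sum.inl j => Sum.inl ⟨j.1 - 1, by have := j.2; omega⟩
  | Sum.inr ⟨i, x⟩ =>
    if x.1 = [] then Sum.inl i else Sum.inr ⟨i, x.1.dropLast, valid_dropLast _ _ x.2⟩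

def dep : Vtx k Tsh → ℕ
  | Sum.inl j => j.1
  | Sum.inr ⟨i, x⟩ => i.1 + 1 + x.1.length

def IsRt (v : Vtx k Tsh) : Prop := dep v = 0

theorem isRt_iff (v : Vtx k Tsh) : IsRt v ↔ ∃ j : Fin (3*k), j.1 = 0 ∧ v = Sum.inl j := by
  rcases v with j | ⟨i, x⟩
  · simp [IsRt, dep]
  · simp [IsRt, dep]

theorem dep_par (v : Vtx k Tsh) (hv : ¬ IsRt v) : dep (par v) < dep v := by
  rcases v with j | ⟨i, x⟩
  · simp [IsRt, dep, par] at *; omega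
  · unfold par
    by_cases h : x.1 = []
    · simp [h, dep]
    · have : 0 < x.1.length := List.length_pos_iff.2 h
      simp [h, dep]; omega

theorem adj_par (v : Vtx k Tsh) (hv : ¬ IsRt v) : (TGraph k Tsh).Adj v (par v) := by
  have hne : v ≠ par v := by
    intro h
    have := dep_par v hv
    rw [← h] at this; omega
  unfold TGraph
  rw [SimpleGraph.fromRel_adj]
  refine ⟨hne, Or.inr ?_⟩
  rcases v with j | ⟨i, x⟩
  · simp [IsRt, dep, par] at *; omega
  · by_cases h : x.1 = []
    · simp [par, h]
    · simp only [par, h, if_false]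
      exact ⟨trivial, x.1.getLast h, (List.dropLast_append_getLast h).symm⟩

def IsTop (EP : Set (Sym2 (Vtx k Tsh))) (v : Vtx k Tsh) : Prop := IsRt v ∨ s(v, par v) ∈ EP

open Classical in
noncomputable def top (EP : Set (Sym2 (Vtx k Tsh))) (v : Vtx k Tsh) : Vtx k Tsh :=
  if _h : IsTop EP v then v else top EP (par v)
termination_by dep v
decreasing_by exact dep_par v (fun h' => _h (Or.inl h'))

variable (EP : Set (Sym2 (Vtx k Tsh)))

theorem top_of (v : Vtx k Tsh) (h : IsTop EP v) : top EP v = v := by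
  rw [top, dif_pos h]

theorem top_of_not (v : Vtx k Tsh) (h : ¬ IsTop EP v) : top EP v = top EP (par v) := by
  rw [top, dif_neg h]

theorem top_ind (p : Vtx k Tsh → Prop) (h1 : ∀ v, IsTop EP v → p v)
    (h2 : ∀ v, ¬ IsTop EP v → p (par v) → p v) (v : Vtx k Tsh) : p v := by
  induction hn : dep v using Nat.strong_induction_on generalizing v with
  | _ n ih =>
    by_cases h : IsTop EP v
    · exact h1 v h
    · exact h2 v h (ih _ (by rw [← hn]; exact dep_par v (fun h' => h (Or.inl h'))) _ rfl)

theorem top_isTop (v : Vtx k Tsh) : IsTop EP (top EP v) := by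
  induction v using top_ind EP with
  | h1 v h => rwa [top_of EP v h]
  | h2 v h ih => rwa [top_of_not EP v h]

theorem top_reach (v : Vtx k Tsh) : ((TGraph k Tsh).deleteEdges EP).Reachable v (top EP v) := by
  induction v using top_ind EP with
  | h1 v h => rw [top_of EP v h]
  | h2 v h ih =>
    rw [top_of_not EP v h]
    refine SimpleGraph.Reachable.trans (SimpleGraph.Adj.reachable ?_) ih
    rw [SimpleGraph.deleteEdges_adj]
    exact ⟨adj_par v (fun h' => h (Or.inl h')), fun h' => h (Or.inr h')⟩

/-- Descendants of position `l` in `T_i`. -/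
def DS (i : Fin (3*k)) (l : List Bool) : Set (Vtx k Tsh) :=
  {v | ∃ x : {l : List Bool // (Tsh i).Valid l}, l <+: x.1 ∧ v = Sum.inr ⟨i, x⟩}

theorem DS_card (i : Fin (3*k)) (l : List Bool) :
    (DS i l : Set (Vtx k Tsh)).ncard = (subt (Tsh i) l).size := by
  rw [← sub_card]
  refine Set.ncard_congr' ?_ |>.symm
  refine ⟨fun x => ⟨Sum.inr ⟨i, x.1, x.2.1⟩, ⟨x.1, x.2.1⟩, x.2.2, rfl⟩,
    fun v => ⟨(match v.1 with | Sum.inl _ => [] | Sum.inr y => y.2.1), ?_⟩, ?_, ?_⟩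
  · obtain ⟨v, x, hx, rfl⟩ := v
    exact ⟨x.2, hx⟩
  · rintro ⟨x, hx⟩; rfl
  · rintro ⟨v, x, hx, rfl⟩; rfl

/-- A vertex whose parent is in `DS i l` is in `DS i l`. -/
theorem par_mem_DS (i : Fin (3*k)) (l : List Bool) (v : Vtx k Tsh) (h : par v ∈ DS i l) :
    v ∈ DS i l := by
  obtain ⟨x, hx, e⟩ := h
  rcases v with j | ⟨j, y⟩
  · simp [par] at e
  · by_cases hy : y.1 = []
    · simp [par, hy] at e
    · simp only [par, hy, if_false, Sum.inr.injEq] at e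
      obtain ⟨rfl, e2⟩ := Sigma.mk.inj_iff.1 e
      have e3 := congrArg Subtype.val (eq_of_heq e2)
      refine ⟨y, ?_, rfl⟩
      rw [← e3] at hx
      exact hx.trans (List.dropLast_prefix _)

theorem mem_DS_par (i : Fin (3*k)) (l : List Bool) (x : {l : List Bool // (Tsh i).Valid l})
    (h : l <+: x.1) (hne : x.1 ≠ l) : par (Sum.inr ⟨i, x⟩ : Vtx k Tsh) ∈ DS i l := by
  have hx : x.1 ≠ [] := by
    intro h0
    rw [h0] at h hne
    exact hne (List.prefix_nil.1 h).symm
  simp only [par, hx, if_false]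
  refine ⟨⟨x.1.dropLast, valid_dropLast _ _ x.2⟩, ?_, rfl⟩
  have h5 := List.prefix_concat_iff (l₁ := l) (l₂ := x.1.dropLast) (a := x.1.getLast hx)
  rw [List.dropLast_append_getLast hx] at h5
  rcases h5.1 h with h | h
  · exact absurd h.symm hne
  · exact h

theorem top_sub (i : Fin (3*k)) (l : {l : List Bool // (Tsh i).Valid l}) (v : Vtx k Tsh)
    (h : top EP v = Sum.inr ⟨i, l⟩) : v ∈ DS i l.1 := by
  induction v using top_ind EP with
  | h1 v h' => rw [top_of EP v h'] at h; exact ⟨l, List.prefix_rfl, h⟩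
  | h2 v h' ih =>
    rw [top_of_not EP v h'] at h
    exact par_mem_DS _ _ _ (ih h)

theorem top_mem (i : Fin (3*k)) (l : {l : List Bool // (Tsh i).Valid l})
    (hl : IsTop EP (Sum.inr ⟨i, l⟩)) (v : Vtx k Tsh)
    (h : v ∈ DS i l.1) : top EP v ∈ DS i l.1 := by
  induction v using top_ind EP with
  | h1 v h' => rwa [top_of EP v h']
  | h2 v h' ih =>
    rw [top_of_not EP v h']
    apply ih
    obtain ⟨x, hx, rfl⟩ := h
    apply mem_DS_par i l.1 x hx
    intro e
    exact h' (by rwa [show x = l from Subtype.ext e])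

theorem top_Ti (i : Fin (3*k)) (v : Vtx k Tsh) (h : v ∈ DS i []) :
    top EP v ∈ DS i [] ∨ top EP v = top EP (Sum.inl i) := by
  induction v using top_ind EP with
  | h1 v h' => rw [top_of EP v h']; exact Or.inl h
  | h2 v h' ih =>
    rw [top_of_not EP v h']
    obtain ⟨x, hx, rfl⟩ := h
    by_cases e : x.1 = []
    · right; simp [par, e]
    · exact ih (mem_DS_par i [] x hx e)

theorem vtx_finite : Finite (Vtx k Tsh) := by
  have : ∀ i : Fin (3*k), Finite {l : List Bool // (Tsh i).Valid l} := fun i => (valid_card (Tsh i)).1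
  infer_instance

theorem tops_card (hfin : EP.Finite) : {v | IsTop EP v}.ncard ≤ EP.ncard + 1 := by
  have := vtx_finite (k := k) (Tsh := Tsh)
  have h1 : {v : Vtx k Tsh | IsTop EP v} ⊆ {v | IsRt v} ∪ {v | ¬ IsRt v ∧ s(v, par v) ∈ EP} := by
    intro v hv
    by_cases h : IsRt v
    · exact Or.inl h
    · exact Or.inr ⟨h, hv.resolve_left h⟩
  have h2 : {v : Vtx k Tsh | IsRt v}.ncard ≤ 1 := by
    rw [Set.ncard_le_one]
    intro a ha b hb
    obtain ⟨i, hi, rfl⟩ := (isRt_iff _).1 ha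
    obtain ⟨j, hj, rfl⟩ := (isRt_iff _).1 hb
    congr 1; ext; omega
  have h3 : {v | ¬ IsRt v ∧ s(v, par v) ∈ EP}.ncard ≤ EP.ncard := by
    refine Set.ncard_le_ncard_of_injOn (fun v => s(v, par v)) (fun v hv => hv.2) ?_ hfin
    intro u hu v hv e
    simp only [Sym2.eq_iff] at e
    rcases e with ⟨e, _⟩ | ⟨e1, e2⟩
    · exact e
    · have := dep_par u hu.1
      have := dep_par v hv.1
      rw [e2] at *
      rw [← e1] at *
      omega
  calc _ ≤ _ := Set.ncard_le_ncard h1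
    _ ≤ _ := Set.ncard_union_le _ _
    _ ≤ _ := by omega

end graph
end TP
namespace TP
section fin
variable {k : ℕ} {Tsh : Fin (3*k) → RBT}

theorem edge_eq (u v : Vtx k Tsh) (hu : ¬ IsRt u) (hv : ¬ IsRt v)
    (e : s(u, par u) = s(v, par v)) : u = v := by
  simp only [Sym2.eq_iff] at e
  rcases e with ⟨e, _⟩ | ⟨e1, e2⟩
  · exact e
  · have := dep_par u hu
    have := dep_par v hv
    rw [e2] at *
    rw [← e1] at *
    omega

theorem inr_notRt (x) : ¬ IsRt (Sum.inr x : Vtx k Tsh) := by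
  rcases x with ⟨i, x⟩
  simp [IsRt, dep]

theorem reach_step (u v : Vtx k Tsh) (hu : ¬ IsRt u) (hv : ¬ IsRt v) (h : v ≠ u) :
    ((TGraph k Tsh).deleteEdges {s(u, par u)}).Reachable v (par v) := by
  apply SimpleGraph.Adj.reachable
  rw [SimpleGraph.deleteEdges_adj]
  refine ⟨adj_par v hv, ?_⟩
  intro e
  exact h (edge_eq v u hv hu e)

theorem reach_up (u : Vtx k Tsh) (hu : ¬ IsRt u) (i : Fin (3*k)) (n : ℕ) (v : Vtx k Tsh)
    (hn : dep v = n) (hv : v ∈ DS i []) (hd : dep v < dep u) :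
    ((TGraph k Tsh).deleteEdges {s(u, par u)}).Reachable v (Sum.inl i) := by
  induction n using Nat.strong_induction_on generalizing v with
  | _ n ih =>
    obtain ⟨x, hx, rfl⟩ := hv
    have h1 := dep_par _ (inr_notRt (k := k) (Tsh := Tsh) ⟨i, x⟩)
    have h2 := reach_step u _ hu (inr_notRt (k := k) (Tsh := Tsh) ⟨i, x⟩) (by rintro rfl; omega)
    by_cases e : x.1 = []
    · simpa [par, e] using h2
    · exact h2.trans (ih _ (by omega) _ rfl (mem_DS_par i [] x hx e) (by omega))

theorem reach_down (i : Fin (3*k)) (y : {l : List Bool // (Tsh i).Valid l}) (n : ℕ) (v : Vtx k Tsh)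
    (hn : dep v = n) (hv : v ∈ DS i y.1) :
    ((TGraph k Tsh).deleteEdges {s(Sum.inr ⟨i, y⟩, par (Sum.inr ⟨i, y⟩))}).Reachable v (Sum.inr ⟨i, y⟩) := by
  induction n using Nat.strong_induction_on generalizing v with
  | _ n ih =>
    obtain ⟨x, hx, rfl⟩ := hv
    by_cases e : x.1 = y.1
    · rw [show x = y from Subtype.ext e]
    · have h1 := dep_par _ (inr_notRt (k := k) (Tsh := Tsh) ⟨i, x⟩)
      have h2 := reach_step (Sum.inr ⟨i, y⟩) _ (inr_notRt _) (inr_notRt (k := k) (Tsh := Tsh) ⟨i, x⟩)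
        (by intro h; simp at h; exact e (congrArg Subtype.val h))
      exact h2.trans (ih _ (by omega) _ rfl (mem_DS_par i y.1 x hx e))

theorem par_of_append (i : Fin (3*k)) (x y : {l : List Bool // (Tsh i).Valid l}) (c : Bool)
    (h : y.1 = x.1 ++ [c]) : par (Sum.inr ⟨i, y⟩ : Vtx k Tsh) = Sum.inr ⟨i, x⟩ := by
  have : y.1 ≠ [] := by simp [h]
  simp only [par, this, if_false]
  congr 2
  ext1
  simp [h]

theorem small_top (EP : Set (Sym2 (Vtx k Tsh))) (i : Fin (3*k)) (C : Set (Vtx k Tsh))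
    (hC : C ⊆ TiSet k Tsh i) (hP : IsPComp (TGraph k Tsh) EP C) (eu ev : Vtx k Tsh)
    (heu : eu ∈ TiSet k Tsh i) (hev : ev ∈ TiSet k Tsh i) (hadj : (TGraph k Tsh).Adj eu ev)
    (hevC : ev ∈ C)
    (hCe : C = {w | ((TGraph k Tsh).deleteEdges {s(eu, ev)}).Reachable ev w}) :
    ∃ y : {l : List Bool // (Tsh i).Valid l}, IsTop EP (Sum.inr ⟨i, y⟩) ∧
      (subt (Tsh i) y.1).size ≤ C.ncard := by
  have := vtx_finite (k := k) (Tsh := Tsh)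
  obtain ⟨x, rfl⟩ := heu
  obtain ⟨y, rfl⟩ := hev
  have hpi : (Sum.inl i : Vtx k Tsh) ∉ C := by
    intro h
    obtain ⟨z, hz⟩ := hC h
    simp at hz
  have hcase : (∃ c, y.1 = x.1 ++ [c]) ∨ (∃ c, x.1 = y.1 ++ [c]) := by
    unfold TGraph at hadj
    rw [SimpleGraph.fromRel_adj] at hadj
    simpa using hadj.2
  rcases hcase with ⟨c, hc⟩ | ⟨c, hc⟩
  · have hpar := par_of_append i x y c hc
    have hes : s((Sum.inr ⟨i, x⟩ : Vtx k Tsh), Sum.inr ⟨i, y⟩) =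
        s((Sum.inr ⟨i, y⟩ : Vtx k Tsh), par (Sum.inr ⟨i, y⟩)) := by
      rw [hpar, Sym2.eq_swap]
    have hup := reach_up (Sum.inr ⟨i, y⟩ : Vtx k Tsh) (inr_notRt _) i _ (Sum.inr ⟨i, x⟩) rfl
      ⟨x, List.nil_prefix, rfl⟩ (by rw [← hpar]; exact dep_par _ (inr_notRt _))
    rw [hes] at hCe
    refine ⟨y, Or.inr ?_, ?_⟩
    · by_contra hcut
      have hx : (Sum.inr ⟨i, x⟩ : Vtx k Tsh) ∈ C := by
        obtain ⟨v, rfl⟩ := hP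
        refine SimpleGraph.Reachable.trans hevC (SimpleGraph.Adj.reachable ?_)
        rw [SimpleGraph.deleteEdges_adj]
        refine ⟨hadj.symm, ?_⟩
        rwa [← hpar]
      apply hpi
      rw [hCe] at hx ⊢
      exact SimpleGraph.Reachable.trans hx hup
    · rw [← DS_card]
      apply Set.ncard_le_ncard _ (Set.toFinite _)
      intro v hv
      rw [hCe]
      exact (reach_down i y _ v rfl hv).symm
  · exfalso
    have hpar := par_of_append i y x c hc
    have hes : s((Sum.inr ⟨i, x⟩ : Vtx k Tsh), Sum.inr ⟨i, y⟩) =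
        s((Sum.inr ⟨i, x⟩ : Vtx k Tsh), par (Sum.inr ⟨i, x⟩)) := by
      rw [hpar]
    apply hpi
    rw [hCe, hes]
    exact reach_up (Sum.inr ⟨i, x⟩ : Vtx k Tsh) (inr_notRt _) i _ (Sum.inr ⟨i, y⟩) rfl
      ⟨y, List.nil_prefix, rfl⟩ (by rw [← hpar]; exact dep_par _ (inr_notRt _))

end fin

/-- size of the full subtree below a vertex of some `T_i` (junk on the path). -/
def Dsz {k : ℕ} {Tsh : Fin (3*k) → RBT} : Vtx k Tsh → ℕ
  | Sum.inl _ => 0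
  | Sum.inr ⟨i, y⟩ => (subt (Tsh i) y.1).size

end TP

open TP

/-- For every solution `P` of the instance `(T, 6k−1, 4k)` and every `i`,
the subtree `T_i` contains no lowest `P`-component with fewer than `s/4` vertices,
where a lowest `P`-component in `T_i` is a `P`-component that equals the full subtree
below some edge of `T_i`. -/
theorem statement2
    (k s : ℕ) (hk : 1 ≤ k) (hs4 : 4 ∣ s) (hs : 24 * k < s)
    (a : Fin (3*k) → ℕ) (ha : ∀ i, s / 4 + 6 * k ≤ a i ∧ a i ≤ s / 2 - 18 * k)
    (Lsh Rsh : Fin (3*k) → RBT)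
    (hL : ∀ i, (Lsh i).IsNice ∧ (Lsh i).size = a i)
    (hR : ∀ i, (Rsh i).IsNice ∧ (Rsh i).size = s - 2)
    (EP : Set (Sym2 (Vtx k (nodes Lsh Rsh)))) (lam : Vtx k (nodes Lsh Rsh) → Fin (4*k))
    (hP : IsSolutionEq (TGraph k (nodes Lsh Rsh)) EP (6*k - 1) (4*k) (fun _ => s) lam)
    (i : Fin (3*k)) :
    ¬ ∃ C : Set (Vtx k (nodes Lsh Rsh)),
        C ⊆ TiSet k (nodes Lsh Rsh) i ∧
        IsPComp (TGraph k (nodes Lsh Rsh)) EP C ∧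
        (∃ eu ev : Vtx k (nodes Lsh Rsh),
          eu ∈ TiSet k (nodes Lsh Rsh) i ∧ ev ∈ TiSet k (nodes Lsh Rsh) i ∧
          (TGraph k (nodes Lsh Rsh)).Adj eu ev ∧ ev ∈ C ∧
          C = {w | ((TGraph k (nodes Lsh Rsh)).deleteEdges {s(eu, ev)}).Reachable ev w}) ∧
        C.ncard < s / 4 := by
  classical
  have hVf := vtx_finite (k := k) (Tsh := nodes Lsh Rsh)
  have : Fintype (Vtx k (nodes Lsh Rsh)) := Fintype.ofFinite _
  rintro ⟨C, hC, hPC, ⟨eu, ev, heu, hev, hadj, hevC, hCe⟩, hsm⟩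
  obtain ⟨y, hy, hyC⟩ := small_top EP i C hC hPC eu ev heu hev hadj hevC hCe
  obtain ⟨hEP, hcard, hlam, hsz⟩ := hP
  have hcnt := tops_card EP (Set.toFinite _)
  let X : Finset (Vtx k (nodes Lsh Rsh)) := Finset.univ.filter (fun v => IsTop EP v)
  let w : Vtx k (nodes Lsh Rsh) → ℕ := fun t => (Finset.univ.filter (fun v => top EP v = t)).card
  let DF : Fin (3*k) → List Bool → Finset (Vtx k (nodes Lsh Rsh)) :=
    fun j l => Finset.univ.filter (fun v => v ∈ DS j l)
  have hDF : ∀ j l, (DF j l).card = (subt (nodes Lsh Rsh j) l).size := by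
    intro j l
    rw [← DS_card, ← Set.ncard_coe_finset]
    congr 1; ext v; simp [DF]
  let In : Fin (3*k) → Finset (Vtx k (nodes Lsh Rsh)) := fun j => X.filter (fun v => v ∈ DS j [])
  have hlamtop : ∀ v, lam (top EP v) = lam v := fun v => (hlam _ _ (top_reach EP v)).symm
  have hg : ∀ g, ∑ t ∈ X with lam t = g, w t = s := by
    intro g
    have hszg : {v | lam v = g}.ncard = s := hsz g
    rw [← hszg]
    have : {v | lam v = g} = ((Finset.univ.filter (fun v => lam v = g) : Finset _) : Set _) := by
      ext v; simp
    rw [this, Set.ncard_coe_finset,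
      Finset.card_eq_sum_card_fiberwise (f := top EP) (t := X.filter (fun t => lam t = g))]
    · refine Finset.sum_congr rfl (fun t ht => ?_)
      simp only [w]
      congr 1
      ext v
      simp only [Finset.mem_filter, Finset.mem_univ, true_and] at ht ⊢
      constructor
      · intro h; exact ⟨by rw [← hlamtop, h]; exact ht.2, h⟩
      · exact fun h => h.2
    · intro v hv
      simp only [Finset.coe_filter, Finset.mem_univ, true_and, Set.mem_ofPred_eq, X,
        Finset.mem_filter] at hv ⊢
      exact ⟨top_isTop EP v, by rw [hlamtop]; exact hv⟩
  have hwle : ∀ t ∈ X, w t ≤ s := by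
    intro t ht
    rw [← hg (lam t)]
    exact Finset.single_le_sum (f := w) (fun _ _ => Nat.zero_le _) (by simp [ht])
  have hInm : ∀ j t, t ∈ In j ↔ ∃ z, t = Sum.inr ⟨j, z⟩ ∧ IsTop EP t := by
    intro j t
    simp only [In, X, Finset.mem_filter, Finset.mem_univ, true_and]
    constructor
    · rintro ⟨h, z, _, rfl⟩; exact ⟨z, rfl, h⟩
    · rintro ⟨z, rfl, h⟩; exact ⟨h, z, List.nil_prefix, rfl⟩
  have hdec : ∀ j (z : {l : List Bool // (nodes Lsh Rsh j).Valid l}), IsTop EP (Sum.inr ⟨j, z⟩) →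
      (subt (nodes Lsh Rsh j) z.1).size = ∑ u ∈ (In j).filter (fun v => v ∈ DS j z.1), w u := by
    intro j z hz
    rw [← hDF, Finset.card_eq_sum_card_fiberwise (f := top EP)
      (t := (In j).filter (fun v => v ∈ DS j z.1))]
    · refine Finset.sum_congr rfl (fun t ht => ?_)
      simp only [w]
      congr 1
      ext v
      simp only [Finset.mem_filter, Finset.mem_univ, true_and, DF] at ht ⊢
      constructor
      · exact fun h => h.2
      · intro h
        refine ⟨?_, h⟩
        obtain ⟨_, x, hx, rfl⟩ := ht
        obtain ⟨x', hx', rfl⟩ := top_sub EP j x v h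
        exact ⟨x', hx.trans hx', rfl⟩
    · intro v hv
      simp only [Finset.coe_filter, Finset.mem_univ, true_and, Set.mem_ofPred_eq, DF] at hv ⊢
      have h := top_mem EP j z hz v hv
      refine ⟨?_, h⟩
      obtain ⟨x', hx', e⟩ := h
      exact (hInm _ _).2 ⟨x', e, top_isTop EP v⟩
  have hroot : ∀ j, (subt (nodes Lsh Rsh j) []).size = a j + s - 1 := by
    intro j
    have := (hL j).2
    have := (hR j).2
    simp only [subt, nodes, RBT.size]
    omega
  refine core k s hk hs4 hs a ha X ?_ lam w Dsz hg In ?_ ?_ ?_ ?_ ?_ ?_ ?_ i (Sum.inr ⟨i, y⟩) ?_ ?_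
  · have : {v | IsTop EP v} = (X : Set (Vtx k (nodes Lsh Rsh))) := by ext v; simp [X]
    rw [this, Set.ncard_coe_finset, hcard] at hcnt
    omega
  · intro j; exact Finset.filter_subset _ _
  · intro j l hjl
    rw [Finset.disjoint_left]
    intro t ht ht'
    obtain ⟨z, rfl, _⟩ := (hInm _ _).1 ht
    obtain ⟨z', e, _⟩ := (hInm _ _).1 ht'
    simp at e
    exact hjl e.1
  · intro j
    have h1 : (DF j []).card + 1 ≤ ∑ t ∈ In j, w t + w (top EP (Sum.inl j)) := by
      have hsub : insert (Sum.inl j) (DF j []) ⊆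
          ((In j).biUnion (fun t => Finset.univ.filter (fun v => top EP v = t))) ∪
          Finset.univ.filter (fun v => top EP v = top EP (Sum.inl j)) := by
        intro v hv
        rw [Finset.mem_insert] at hv
        rw [Finset.mem_union]
        rcases hv with rfl | hv
        · right; simp
        · simp only [DF, Finset.mem_filter, Finset.mem_univ, true_and] at hv
          rcases top_Ti EP j v hv with h | h
          · left
            obtain ⟨x', hx', e⟩ := h
            simp only [Finset.mem_biUnion, Finset.mem_filter, Finset.mem_univ, true_and]
            exact ⟨_, (hInm _ _).2 ⟨x', e, top_isTop EP v⟩, rfl⟩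
          · right; simp [h]
      have hnot : (Sum.inl j : Vtx k (nodes Lsh Rsh)) ∉ DF j [] := by
        simp [DF, DS]
      rw [← Finset.card_insert_of_notMem hnot]
      refine (Finset.card_le_card hsub).trans ((Finset.card_union_le _ _).trans ?_)
      exact Nat.add_le_add_right Finset.card_biUnion_le _
    have h2 := hwle (top EP (Sum.inl j)) (by simp [X, top_isTop])
    rw [hDF, hroot] at h1
    omega
  · intro j t ht
    obtain ⟨z, rfl, hz⟩ := (hInm _ _).1 ht
    simp only [Dsz]
    rw [hdec j z hz]
    exact Finset.single_le_sum (f := w) (fun _ _ => Nat.zero_le _)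
      (Finset.mem_filter.2 ⟨ht, z, List.prefix_rfl, rfl⟩)
  · intro j t ht
    obtain ⟨z, rfl, hz⟩ := (hInm _ _).1 ht
    by_cases e : z.1 = []
    · left
      have h1 := hdec j z hz
      simp only [Dsz]
      rw [e] at h1 ⊢
      refine ⟨hroot j, ?_⟩
      rw [h1]
      refine Finset.sum_congr ?_ (fun _ _ => rfl)
      simp [In, Finset.filter_filter]
    · right
      exact cls_lemma s k (a j) hk hs4 hs (ha j) _ _ (hL j) (hR j) z.1 e
  · have key : ∀ j (z : {l : List Bool // (nodes Lsh Rsh j).Valid l}),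
        Dsz (Sum.inr ⟨j, z⟩ : Vtx k (nodes Lsh Rsh)) = a j + s - 1 → z.1 = [] := by
      intro j z h
      by_contra e
      have h1 := cls_lemma s k (a j) hk hs4 hs (ha j) _ _ (hL j) (hR j) z.1 e
      simp only [Dsz, nodes] at h
      rw [h] at h1
      have := ha j
      unfold Cls at h1
      omega
    intro j t ht u hu e1 e2
    obtain ⟨z, rfl, hz⟩ := (hInm _ _).1 ht
    obtain ⟨z', rfl, hz'⟩ := (hInm _ _).1 hu
    have : z = z' := Subtype.ext ((key j z e1).trans (key j z' e2).symm)
    rw [this]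
  · intro j t ht
    obtain ⟨z, rfl, hz⟩ := (hInm _ _).1 ht
    exact ⟨_, Finset.filter_subset _ _, Finset.mem_filter.2 ⟨ht, z, List.prefix_rfl, rfl⟩, hdec j z hz⟩
  · exact (hInm _ _).2 ⟨y, rfl, hy⟩
  · simp only [Dsz]
    omega
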